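/- arXiv:0802.2978 — 5 statements merged into one kernel-verified Lean document; each statement's English description precedes it below -/
import Mathlib

section
/- Let s : ℝ → ℝ be continuous on [0,∞) and differentiable on [0,∞), and let φ > 0, η > 0. Suppose that for every t ≥ 0 with |s(t)| > φ one has s(t)·s'(t) ≤ −η·|s(t)|. Then there exists a time t* with 0 ≤ t* ≤ max(|s(0)| − φ, 0)/η such that |s(t*)| ≤ φ, and moreover |s(t)| ≤ φ for all t ≥ t*. -/
/-- Where `φ < |s|` and `s · s' ≤ -η |s|`, the absolute value `|s|` decreases at rate at least
`η`. -/
theorem abs_le_abs_sub_of_mul_deriv_le {s : ℝ → ℝ} {φ η a b : ℝ} (hφ : 0 ≤ φ) (hab : a ≤ b)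
    (hcont : ContinuousOn s (Set.Icc a b))
    (hdiff : ∀ t ∈ Set.Ioo a b, DifferentiableAt ℝ s t)
    (hineq : ∀ t ∈ Set.Ioo a b, φ < |s t| → s t * deriv s t ≤ -η * |s t|)
    (hout : ∀ t ∈ Set.Ioo a b, φ < |s t|) :
    |s b| ≤ |s a| - η * (b - a) := by
  have hderiv : ∀ t ∈ Set.Ioo a b,
      HasDerivAt (fun x => |s x|) (SignType.sign (s t) * deriv s t) t := fun t ht =>
    (hasDerivAt_abs (abs_pos.1 (hφ.trans_lt (hout t ht)))).comp t (hdiff t ht).hasDerivAt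
  have key := (convex_Icc a b).image_sub_le_mul_sub_of_deriv_le (f := fun x => |s x|) (C := -η)
    hcont.abs
    (by
      rw [interior_Icc]
      exact fun t ht => (hderiv t ht).differentiableAt.differentiableWithinAt)
    (by
      rw [interior_Icc]
      intro t ht
      rw [(hderiv t ht).deriv]
      have hpos := hφ.trans_lt (hout t ht)
      refine le_of_mul_le_mul_left ?_ hpos
      have h := hineq t ht (hout t ht)
      calc |s t| * (SignType.sign (s t) * deriv s t) = s t * deriv s t := by
            rw [← mul_assoc, abs_mul_sign]
        _ ≤ |s t| * -η := by linarith)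
    a (Set.left_mem_Icc.2 hab) b (Set.right_mem_Icc.2 hab) hab
  linarith

/-- Theorem 1: If `s` is continuous and differentiable on `[0,∞)` and satisfies
`s·s' ≤ -η·|s|` whenever `|s| > φ`, then there is `t* ∈ [0, max (|s 0| - φ) 0 / η]` with
`|s t*| ≤ φ`, and `|s t| ≤ φ` for all `t ≥ t*` (attractiveness and invariance of the
boundary layer). -/
theorem smc_boundary_layer_reaching (s : ℝ → ℝ) (φ η : ℝ) (hφ : 0 < φ) (hη : 0 < η)
    (hcont : ContinuousOn s (Set.Ici (0 : ℝ)))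
    (hdiff : ∀ t ≥ (0 : ℝ), DifferentiableAt ℝ s t)
    (hineq : ∀ t ≥ (0 : ℝ), φ < |s t| → s t * deriv s t ≤ -η * |s t|) :
    ∃ tstar : ℝ, 0 ≤ tstar ∧ tstar ≤ max (|s 0| - φ) 0 / η ∧ |s tstar| ≤ φ ∧
      ∀ t ≥ tstar, |s t| ≤ φ := by
  have hT : 0 ≤ max (|s 0| - φ) 0 / η := div_nonneg (le_max_right _ _) hη.le
  have decay : ∀ a t : ℝ, 0 ≤ a → a ≤ t → (∀ x ∈ Set.Ioo a t, φ < |s x|) →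
      |s t| ≤ |s a| - η * (t - a) := fun a t ha hat hout =>
    abs_le_abs_sub_of_mul_deriv_le hφ.le hat
      (hcont.mono fun x hx => ha.trans hx.1) (fun x hx => hdiff x (ha.trans hx.1.le))
      (fun x hx => hineq x (ha.trans hx.1.le)) hout
  suffices h : ∀ t ≥ max (|s 0| - φ) 0 / η, |s t| ≤ φ from
    ⟨_, hT, le_rfl, h _ le_rfl, h⟩
  intro t ht
  have ht0 : 0 ≤ t := hT.trans ht
  by_cases hne : (Set.Icc 0 t ∩ (fun x => |s x|) ⁻¹' Set.Iic φ).Nonempty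
  · have hclosed : IsClosed (Set.Icc 0 t ∩ (fun x => |s x|) ⁻¹' Set.Iic φ) :=
      (hcont.mono Set.Icc_subset_Ici_self).abs.preimage_isClosed_of_isClosed isClosed_Icc
        isClosed_Iic
    obtain ⟨c, ⟨⟨hc0, hct⟩, hc⟩, hmax⟩ :=
      (isCompact_Icc.of_isClosed_subset hclosed Set.inter_subset_left).exists_isGreatest hne
    have hle := decay c t hc0 hct fun x hx => not_le.1 fun hx' =>
      (hmax ⟨⟨hc0.trans hx.1.le, hx.2.le⟩, hx'⟩).not_gt hx.1
    have hc' : |s c| ≤ φ := hc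
    have := mul_nonneg hη.le (sub_nonneg.2 hct)
    linarith
  · have hle := decay 0 t le_rfl ht0 fun x hx => not_le.1 fun hx' =>
      hne ⟨x, ⟨hx.1.le, hx.2.le⟩, hx'⟩
    have hmul := (div_le_iff₀ hη).1 ht
    have := le_max_left (|s 0| - φ) 0
    linarith
end

section
/- Let f, f̂, F, v, η, s, b, b_min, b_max, K be real numbers with |f̂ − f| ≤ F, 0 < b_min, b_min ≤ b, b ≤ b_max, and η > 0. Set b̂ = √(b_max·b_min) and β = √(b_max/b_min), and suppose K ≥ β·b̂⁻¹·(η + F) + (β − 1)·|b̂⁻¹·(−f̂ + v)|. Define the control input u = b̂⁻¹·(−f̂ + v) − K·sgn(s), where sgn(s) = 1 if s > 0, sgn(s) = −1 if s < 0, and sgn(0) = 0. Then s·(f + b·u − v) ≤ −η·|s|. -/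
/-- The sign function with `sgn 0 = 0`. -/
noncomputable def sgn (s : ℝ) : ℝ :=
  if 0 < s then 1 else if s < 0 then -1 else 0

/-- A gain that dominates the modelling error and the input-gain mismatch enforces the
sliding condition. -/
theorem mul_sub_mul_sgn_le {d g η s : ℝ} (h : |d| + η ≤ g) :
    s * (d - g * sgn s) ≤ -η * |s| := by
  have hd := abs_le.mp (show |d| ≤ g - η by linarith)
  unfold sgn
  rcases lt_trichotomy s 0 with hs | rfl | hs
  · rw [if_neg hs.not_gt, if_pos hs, abs_of_neg hs]
    nlinarith [hd.1]
  · simp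
  · rw [if_pos hs, abs_of_pos hs]
    nlinarith [hd.2]

/-- If `b` lies within a factor `β` of `c`, then `|b - c| ≤ b * (β - 1)`. -/
theorem abs_sub_le_mul_sub_one {b c β : ℝ} (hc : 0 < c) (hb : 0 < b)
    (hcb : c ≤ b * β) (hbc : b ≤ β * c) : |b - c| ≤ b * (β - 1) := by
  refine abs_le.mpr ⟨by linarith, ?_⟩
  rcases le_total 2 β with h | h
  · nlinarith
  · nlinarith [mul_le_mul_of_nonneg_right hbc (sub_nonneg.mpr h),
      mul_nonneg hc.le (sq_nonneg (β - 1))]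

/-- the pointwise sliding condition `s·ṡ ≤ -η·|s|` for the discontinuous
control law `u = b̂⁻¹(-f̂ + v) - K·sgn s` with gain `K` chosen as in Eq. (6), where
`ṡ = f + b·u - v`. -/
theorem smc_sliding_condition (f fhat F v η s b bmin bmax K : ℝ)
    (hF : |fhat - f| ≤ F) (hbmin : 0 < bmin) (hb1 : bmin ≤ b) (hb2 : b ≤ bmax)
    (hη : 0 < η)
    (bhat : ℝ) (hbhat : bhat = Real.sqrt (bmax * bmin))
    (β : ℝ) (hβ : β = Real.sqrt (bmax / bmin))
    (hK : K ≥ β * bhat⁻¹ * (η + F) + (β - 1) * |bhat⁻¹ * (-fhat + v)|)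
    (u : ℝ) (hu : u = bhat⁻¹ * (-fhat + v) - K * sgn s) :
    s * (f + b * u - v) ≤ -η * |s| := by
  have hb : 0 < b := hbmin.trans_le hb1
  have hbmax : 0 < bmax := hb.trans_le hb2
  have hbhat_pos : 0 < bhat := hbhat ▸ Real.sqrt_pos.mpr (mul_pos hbmax hbmin)
  have hβ_pos : 0 < β := hβ ▸ Real.sqrt_pos.mpr (div_pos hbmax hbmin)
  have hmax : β * bhat = bmax := by
    rw [hβ, hbhat, ← Real.sqrt_mul (div_pos hbmax hbmin).le,
      show bmax / bmin * (bmax * bmin) = bmax ^ 2 by field_simp, Real.sqrt_sq hbmax.le]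
  have hmin : β * bmin = bhat := by
    have hsq : bhat * bhat = bmax * bmin := by
      rw [hbhat]
      exact Real.mul_self_sqrt (mul_pos hbmax hbmin).le
    refine mul_right_cancel₀ hbhat_pos.ne' ?_
    rw [hsq, ← hmax]
    ring
  have hle : bhat ≤ b * β := by nlinarith
  have hgain : 1 ≤ b * (β * bhat⁻¹) := by
    rw [← mul_assoc, ← div_eq_mul_inv, one_le_div hbhat_pos]
    exact hle
  have hmis := abs_sub_le_mul_sub_one hbhat_pos hb hle (hmax ▸ hb2)
  have hw : bhat * (bhat⁻¹ * (-fhat + v)) = -fhat + v := mul_inv_cancel_left₀ hbhat_pos.ne' _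
  subst hu
  generalize bhat⁻¹ * (-fhat + v) = w at hK hw ⊢
  have hηF : 0 ≤ η + F := add_nonneg hη.le ((abs_nonneg _).trans hF)
  have hd : |(f - fhat) + (b - bhat) * w| + η ≤ b * K := by
    calc |(f - fhat) + (b - bhat) * w| + η
        ≤ |f - fhat| + |b - bhat| * |w| + η := by
          rw [← abs_mul]
          gcongr
          exact abs_add_le _ _
      _ ≤ F + b * (β - 1) * |w| + η := by
          rw [abs_sub_comm f]
          gcongr
      _ ≤ b * (β * bhat⁻¹) * (η + F) + b * (β - 1) * |w| := by
          linarith [le_mul_of_one_le_left hηF hgain]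
      _ = b * (β * bhat⁻¹ * (η + F) + (β - 1) * |w|) := by ring
      _ ≤ b * K := mul_le_mul_of_nonneg_left hK hb.le
  convert mul_sub_mul_sgn_le (s := s) hd using 2
  linear_combination hw
end

section
/- Let λ > 0 and φ > 0 be real numbers, let n ≥ 1 be a natural number, and let x̃ : ℝ → ℝ be (n−1)-times continuously differentiable with |Σ_{i=0}^{n−1} C(n−1, i)·λ^{n−1−i}·x̃⁽ⁱ⁾(t)| ≤ φ for all t ≥ 0, where x̃⁽ⁱ⁾ denotes the i-th derivative of x̃ and C(n−1,i) the binomial coefficient. Then limsup_{t→∞} |x̃(t)| ≤ φ/λ^{n−1}; that is, for every ε > 0 there exists T ≥ 0 such that |x̃(t)| ≤ φ/λ^{n−1} + ε for all t ≥ T. -/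
open Filter Topology in
/-- A differential inequality `f' + lam * f ≤ c` on a half-line forces `f` to be asymptotically at
most `c / lam`. -/
theorem eventually_le_of_deriv_add_mul_le {lam c : ℝ} (hlam : 0 < lam) {f : ℝ → ℝ}
    (hf : Differentiable ℝ f) (h : ∀ᶠ t in atTop, deriv f t + lam * f t ≤ c)
    {ε : ℝ} (hε : 0 < ε) : ∀ᶠ t in atTop, f t ≤ c / lam + ε := by
  obtain ⟨T, hT⟩ := eventually_atTop.1 h
  set g : ℝ → ℝ := fun t => Real.exp (lam * t) * (f t - c / lam) with hg
  have hg' (t : ℝ) : HasDerivAt g (Real.exp (lam * t) * (deriv f t + lam * f t - c)) t := by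
    have h₁ : HasDerivAt (fun t : ℝ => Real.exp (lam * t)) (Real.exp (lam * t) * (lam * 1)) t :=
      ((hasDerivAt_id t).const_mul lam).exp
    refine (h₁.mul ((hf t).hasDerivAt.sub_const (c / lam))).congr_deriv ?_
    field_simp
    ring
  have hanti : AntitoneOn g (Set.Ici T) := by
    refine antitoneOn_of_deriv_nonpos (convex_Ici T)
      (fun t _ => (hg' t).continuousAt.continuousWithinAt)
      (fun t _ => (hg' t).differentiableAt.differentiableWithinAt) fun t ht => ?_
    rw [interior_Ici] at ht
    rw [(hg' t).deriv]
    exact mul_nonpos_of_nonneg_of_nonpos (Real.exp_pos _).le (by linarith [hT t (le_of_lt ht)])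
  have hlim : Tendsto (fun t : ℝ => Real.exp (-(lam * t)) * g T) atTop (𝓝 0) := by
    simpa using (Real.tendsto_exp_neg_atTop_nhds_zero.comp
      (tendsto_id.const_mul_atTop hlam)).mul_const (g T)
  filter_upwards [hlim.eventually_lt_const hε, eventually_ge_atTop T] with t ht htT
  have hle : g t ≤ g T := hanti Set.self_mem_Ici htT htT
  have hmul := mul_le_mul_of_nonneg_left hle (Real.exp_pos (-(lam * t))).le
  have hcancel : Real.exp (-(lam * t)) * g t = f t - c / lam := by
    rw [hg, ← mul_assoc, ← Real.exp_add, neg_add_cancel, Real.exp_zero, one_mul]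
  linarith

open Filter in
/-- Two-sided form of `eventually_le_of_deriv_add_mul_le`. -/
theorem eventually_abs_le_of_abs_deriv_add_mul_le {lam c : ℝ} (hlam : 0 < lam) {f : ℝ → ℝ}
    (hf : Differentiable ℝ f) (h : ∀ᶠ t in atTop, |deriv f t + lam * f t| ≤ c)
    {ε : ℝ} (hε : 0 < ε) : ∀ᶠ t in atTop, |f t| ≤ c / lam + ε := by
  have hupper := eventually_le_of_deriv_add_mul_le hlam hf
    (h.mono fun t ht => (abs_le.1 ht).2) hε
  have hlower := eventually_le_of_deriv_add_mul_le hlam hf.neg (c := c)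
    (h.mono fun t ht => by
      rw [deriv.neg, Pi.neg_apply]
      linarith [(abs_le.1 ht).1]) hε
  filter_upwards [hupper, hlower] with t h₁ h₂
  rw [Pi.neg_apply] at h₂
  exact abs_le.2 ⟨by linarith, h₁⟩

/-- Pascal's rule for binomial sums. -/
theorem sum_choose_succ_mul_pow_mul {R : Type*} [CommSemiring R] (a : R) (u : ℕ → R) (m : ℕ) :
    ∑ i ∈ Finset.range (m + 2), ((m + 1).choose i : R) * a ^ (m + 1 - i) * u i =
      ∑ i ∈ Finset.range (m + 1), (m.choose i : R) * a ^ (m - i) * (u (i + 1) + a * u i) := by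
  have hshift : ∑ i ∈ Finset.range (m + 1), (m.choose i : R) * a ^ (m - i) * (a * u i) =
      ∑ i ∈ Finset.range (m + 1), (m.choose (i + 1) : R) * a ^ (m - i) * u (i + 1) +
        a ^ (m + 1) * u 0 := by
    have hsum := Finset.sum_range_succ' (fun i => (m.choose i : R) * a ^ (m + 1 - i) * u i) (m + 1)
    rw [Finset.sum_range_succ, Nat.choose_succ_self] at hsum
    simp only [Nat.cast_zero, zero_mul, add_zero, Nat.add_sub_add_right, Nat.choose_zero_right,
      Nat.cast_one, one_mul, Nat.sub_zero] at hsum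
    rw [← hsum]
    refine Finset.sum_congr rfl fun i hi => ?_
    rw [Nat.succ_sub (Finset.mem_range_succ_iff.1 hi), pow_succ]
    ring
  rw [Finset.sum_range_succ']
  simp only [mul_add, Finset.sum_add_distrib, hshift, Nat.choose_succ_succ', Nat.cast_add,
    add_mul, Nat.add_sub_add_right, Nat.choose_zero_right, Nat.cast_one, one_mul, Nat.sub_zero]
  ring

theorem iteratedDeriv_deriv_add_const_mul {a : ℝ} {f : ℝ → ℝ} {m i : ℕ} (hi : i ≤ m)
    (hf : ContDiff ℝ (m + 1 : ℕ) f) (t : ℝ) :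
    iteratedDeriv i (fun s => deriv f s + a * f s) t =
      iteratedDeriv (i + 1) f t + a * iteratedDeriv i f t := by
  have hf' : ContDiff ℝ (i + 1 : ℕ) f := hf.of_le (by exact_mod_cast Nat.succ_le_succ hi)
  have hfi : ContDiff ℝ i f := hf.of_le (by exact_mod_cast hi.trans m.le_succ)
  have hd : ContDiff ℝ i (deriv f) := hf'.deriv'
  rw [iteratedDeriv_fun_add hd.contDiffAt (contDiff_const.mul hfi).contDiffAt,
    iteratedDeriv_const_mul_field, iteratedDeriv_succ']

open Filter in
/-- An eventual bound on `(d/dt + lam) ^ m f` bounds `f` asymptotically, with gain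
`1 / lam ^ m`. -/
theorem eventually_abs_le_of_abs_sum_choose_iteratedDeriv_le {lam : ℝ} (hlam : 0 < lam) {φ : ℝ}
    {m : ℕ} {f : ℝ → ℝ} (hf : ContDiff ℝ m f)
    (h : ∀ᶠ t in atTop, |∑ i ∈ Finset.range (m + 1),
      (m.choose i : ℝ) * lam ^ (m - i) * iteratedDeriv i f t| ≤ φ)
    {ε : ℝ} (hε : 0 < ε) : ∀ᶠ t in atTop, |f t| ≤ φ / lam ^ m + ε := by
  induction m generalizing f ε with
  | zero =>
    filter_upwards [h] with t ht
    simp only [zero_add, Finset.range_one, Finset.sum_singleton, Nat.choose_self, Nat.cast_one,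
      Nat.sub_self, pow_zero, one_mul, iteratedDeriv_zero] at ht
    rw [pow_zero, div_one]
    linarith
  | succ m ih =>
    have hf' : ContDiff ℝ m (fun s => deriv f s + lam * f s) :=
      ContDiff.add (ContDiff.deriv' (by exact_mod_cast hf))
        (contDiff_const.mul (hf.of_le (by exact_mod_cast m.le_succ)))
    have hfirst := ih hf' (h.mono fun t ht => by
      rw [sum_choose_succ_mul_pow_mul lam (fun i => iteratedDeriv i f t) m] at ht
      convert ht using 3 with i hi
      rw [iteratedDeriv_deriv_add_const_mul (Finset.mem_range_succ_iff.1 hi) hf])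
      (show 0 < lam * (ε / 2) by positivity)
    have hdiff : Differentiable ℝ f := hf.differentiable (by simp)
    filter_upwards [eventually_abs_le_of_abs_deriv_add_mul_le hlam hdiff hfirst (half_pos hε)]
      with t ht
    refine ht.trans_eq ?_
    field_simp
    ring


/-- Eq. 18: if the sliding variable
`s = ∑_{i=0}^{n-1} C(n-1,i) λ^{n-1-i} x̃⁽ⁱ⁾` remains inside the boundary layer `|s| ≤ φ`
for all `t ≥ 0`, then `limsup_{t→∞} |x̃(t)| ≤ φ/λ^{n-1}` in the sense that for every
`ε > 0` eventually `|x̃(t)| ≤ φ/λ^{n-1} + ε`. -/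
theorem smc_tracking_error_bound (lam φ : ℝ) (hlam : 0 < lam) (hφ : 0 < φ)
    (n : ℕ) (hn : 1 ≤ n) (xt : ℝ → ℝ) (hxt : ContDiff ℝ (n - 1 : ℕ) xt)
    (hs : ∀ t ≥ (0 : ℝ),
      |∑ i ∈ Finset.range n, ((n - 1).choose i : ℝ) * lam ^ (n - 1 - i) * iteratedDeriv i xt t|
        ≤ φ) :
    ∀ ε > (0 : ℝ), ∃ T ≥ (0 : ℝ), ∀ t ≥ T, |xt t| ≤ φ / lam ^ (n - 1) + ε := by
  intro ε hε
  obtain ⟨m, rfl⟩ := Nat.exists_eq_add_of_le' hn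
  rw [Nat.add_sub_cancel] at hxt hs ⊢
  obtain ⟨T, hT⟩ := Filter.eventually_atTop.1
    (eventually_abs_le_of_abs_sum_choose_iteratedDeriv_le hlam hxt
      ((Filter.eventually_ge_atTop 0).mono hs) hε)
  exact ⟨max T 0, le_max_right _ _, fun t ht => hT t ((le_max_left _ _).trans ht)⟩
end

section
/- Let λ > 0 and φ > 0 be real numbers, let n ≥ 3 be a natural number, and let x̃ : ℝ → ℝ be (n−1)-times continuously differentiable with |Σ_{i=0}^{n−1} C(n−1, i)·λ^{n−1−i}·x̃⁽ⁱ⁾(t)| ≤ φ for all t ≥ 0, where x̃⁽ⁱ⁾ denotes the i-th derivative of x̃ and C(n−1,i) the binomial coefficient. Then limsup_{t→∞} |x̃''(t)| ≤ 6φ/λ^{n−3}; that is, for every ε > 0 there exists T ≥ 0 such that |x̃''(t)| ≤ 6φ/λ^{n−3} + ε for all t ≥ T. -/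
open Filter Topology

/-- If `f' + c f = g` with `c > 0` and `g` is asymptotically at most `B`, then `f` is
asymptotically at most `B / c`. -/
lemma eventually_le_div_of_hasDerivAt_sub_mul {c B : ℝ} (hc : 0 < c) {f g : ℝ → ℝ}
    (hf : ∀ t, HasDerivAt f (g t - c * f t) t)
    (hg : ∀ ε > (0 : ℝ), ∀ᶠ t in atTop, g t ≤ B + ε) :
    ∀ ε > (0 : ℝ), ∀ᶠ t in atTop, f t ≤ B / c + ε := by
  intro ε hε
  obtain ⟨T, hT⟩ := eventually_atTop.1 (hg (c * (ε / 2)) (by positivity))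
  set C := B / c + ε / 2 with hC
  have hcC : c * C = B + c * (ε / 2) := by rw [hC]; field_simp
  have hh : ∀ t, HasDerivAt (fun t ↦ Real.exp (c * t) * (f t - C))
      (Real.exp (c * t) * (g t - c * C)) t := by
    intro t
    have he : HasDerivAt (fun t ↦ Real.exp (c * t)) (Real.exp (c * t) * c) t := by
      simpa using ((hasDerivAt_id t).const_mul c).exp
    exact (he.mul ((hf t).sub_const C)).congr_deriv (by ring)
  have hanti : AntitoneOn (fun t ↦ Real.exp (c * t) * (f t - C)) (Set.Ici T) := by
    refine antitoneOn_of_deriv_nonpos (convex_Ici T)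
      (fun t _ ↦ (hh t).continuousAt.continuousWithinAt)
      (fun t _ ↦ (hh t).differentiableAt.differentiableWithinAt) fun t ht ↦ ?_
    rw [interior_Ici] at ht
    rw [(hh t).deriv]
    exact mul_nonpos_of_nonneg_of_nonpos (Real.exp_pos _).le (by linarith [hT t ht.le])
  have hlim : Tendsto (fun t ↦ Real.exp (-(c * t)) * (Real.exp (c * T) * (f T - C)))
      atTop (𝓝 0) := by
    simpa using (Real.tendsto_exp_neg_atTop_nhds_zero.comp
      (tendsto_id.const_mul_atTop hc)).mul_const (Real.exp (c * T) * (f T - C))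
  filter_upwards [hlim.eventually_le_const (half_pos hε), eventually_ge_atTop T] with t ht hTt
  have hle := mul_le_mul_of_nonneg_left (hanti Set.self_mem_Ici hTt hTt)
    (Real.exp_pos (-(c * t))).le
  simp only [← mul_assoc, ← Real.exp_add, neg_add_cancel, Real.exp_zero, one_mul] at hle ht
  linarith

/-- If `f' + c f = g` with `c > 0` and `|g|` is asymptotically at most `B`, then `|f|` is
asymptotically at most `B / c`. -/
lemma eventually_abs_le_div_of_hasDerivAt_sub_mul {c B : ℝ} (hc : 0 < c) {f g : ℝ → ℝ}
    (hf : ∀ t, HasDerivAt f (g t - c * f t) t)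
    (hg : ∀ ε > (0 : ℝ), ∀ᶠ t in atTop, |g t| ≤ B + ε) :
    ∀ ε > (0 : ℝ), ∀ᶠ t in atTop, |f t| ≤ B / c + ε := by
  intro ε hε
  have h₁ := eventually_le_div_of_hasDerivAt_sub_mul hc hf
    (fun ε hε ↦ (hg ε hε).mono fun t ht ↦ (le_abs_self _).trans ht) ε hε
  have h₂ := eventually_le_div_of_hasDerivAt_sub_mul (f := fun t ↦ -f t) (g := fun t ↦ -g t) hc
    (fun t ↦ (hf t).neg.congr_deriv (by ring))
    (fun ε hε ↦ (hg ε hε).mono fun t ht ↦ (neg_le_abs _).trans ht) ε hε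
  filter_upwards [h₁, h₂] with t ht₁ ht₂
  exact abs_le.2 ⟨by linarith, ht₁⟩

/-- The function `(d/dt + c)^k x`, in expanded form. -/
noncomputable def shiftedIteratedDeriv (c : ℝ) (x : ℝ → ℝ) (k : ℕ) (t : ℝ) : ℝ :=
  ∑ i ∈ Finset.range (k + 1), (k.choose i : ℝ) * c ^ (k - i) * iteratedDeriv i x t

lemma shiftedIteratedDeriv_succ (c : ℝ) (x : ℝ → ℝ) (k : ℕ) (t : ℝ) :
    shiftedIteratedDeriv c x (k + 1) t =
      (∑ i ∈ Finset.range (k + 1), (k.choose i : ℝ) * c ^ (k - i) * iteratedDeriv (i + 1) x t) +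
        c * shiftedIteratedDeriv c x k t := by
  have h := Finset.sum_choose_succ_mul (fun i j ↦ c ^ j * iteratedDeriv i x t) k
  simp only [shiftedIteratedDeriv, mul_assoc] at h ⊢
  rw [h, Finset.mul_sum, add_comm]
  congr 1
  refine Finset.sum_congr rfl fun i hi ↦ ?_
  rw [Nat.succ_sub (Finset.mem_range_succ_iff.1 hi), pow_succ]
  ring

lemma hasDerivAt_shiftedIteratedDeriv (c : ℝ) {x : ℝ → ℝ} {m k : ℕ} (hx : ContDiff ℝ m x)
    (hk : k < m) (t : ℝ) :
    HasDerivAt (shiftedIteratedDeriv c x k)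
      (shiftedIteratedDeriv c x (k + 1) t - c * shiftedIteratedDeriv c x k t) t := by
  rw [shiftedIteratedDeriv_succ, add_sub_cancel_right]
  refine HasDerivAt.fun_sum fun i hi ↦ HasDerivAt.const_mul _ ?_
  rw [iteratedDeriv_succ]
  refine (hx.differentiable_iteratedDeriv i ?_ t).hasDerivAt
  exact_mod_cast (Finset.mem_range_succ_iff.1 hi).trans_lt hk

/-- An asymptotic bound `B` on `|(d/dt + c)^m x|` yields the asymptotic bound `B / c ^ j` on
`|(d/dt + c)^(m - j) x|`. -/
lemma eventually_abs_shiftedIteratedDeriv_le {c B : ℝ} (hc : 0 < c) {x : ℝ → ℝ} {m : ℕ}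
    (hx : ContDiff ℝ m x)
    (hB : ∀ ε > (0 : ℝ), ∀ᶠ t in atTop, |shiftedIteratedDeriv c x m t| ≤ B + ε)
    {j k : ℕ} (hjk : k + j = m) :
    ∀ ε > (0 : ℝ), ∀ᶠ t in atTop, |shiftedIteratedDeriv c x k t| ≤ B / c ^ j + ε := by
  induction j generalizing k with
  | zero => simpa [show k = m from hjk] using hB
  | succ j ih =>
    rw [pow_succ, ← div_div]
    exact eventually_abs_le_div_of_hasDerivAt_sub_mul hc
      (hasDerivAt_shiftedIteratedDeriv c hx (by lia)) (ih (by lia))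

lemma iteratedDeriv_two_eq_shiftedIteratedDeriv (c : ℝ) (x : ℝ → ℝ) (t : ℝ) :
    iteratedDeriv 2 x t = shiftedIteratedDeriv c x 2 t - 2 * c * shiftedIteratedDeriv c x 1 t +
      c ^ 2 * shiftedIteratedDeriv c x 0 t := by
  simp only [shiftedIteratedDeriv, Finset.sum_range_succ, Finset.sum_range_zero]
  norm_num
  ring

/-- The sharper form of the bound on the second derivative, with constant `4`. -/
lemma eventually_abs_iteratedDeriv_two_le {c B : ℝ} (hc : 0 < c) {x : ℝ → ℝ} {j : ℕ}
    (hx : ContDiff ℝ (2 + j : ℕ) x)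
    (hB : ∀ ε > (0 : ℝ), ∀ᶠ t in atTop, |shiftedIteratedDeriv c x (2 + j) t| ≤ B + ε) :
    ∀ ε > (0 : ℝ), ∀ᶠ t in atTop, |iteratedDeriv 2 x t| ≤ 4 * B / c ^ j + ε := by
  intro ε hε
  have h₂ := eventually_abs_shiftedIteratedDeriv_le hc hx hB (k := 2) (j := j) rfl
    (ε / 4) (by positivity)
  have h₁ := eventually_abs_shiftedIteratedDeriv_le hc hx hB (k := 1) (j := j + 1) (by lia)
    (ε / (4 * c)) (by positivity)
  have h₀ := eventually_abs_shiftedIteratedDeriv_le hc hx hB (k := 0) (j := j + 2) (by lia)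
    (ε / (4 * c ^ 2)) (by positivity)
  filter_upwards [h₀, h₁, h₂] with t h₀ h₁ h₂
  rw [iteratedDeriv_two_eq_shiftedIteratedDeriv c]
  calc _ ≤ |shiftedIteratedDeriv c x 2 t| + 2 * c * |shiftedIteratedDeriv c x 1 t| +
        c ^ 2 * |shiftedIteratedDeriv c x 0 t| := by
        refine (abs_add_le _ _).trans (add_le_add ((abs_sub _ _).trans_eq ?_) (le_of_eq ?_))
        · rw [abs_mul, abs_of_pos (by positivity : 0 < 2 * c)]
        · rw [abs_mul, abs_of_pos (by positivity : 0 < c ^ 2)]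
    _ ≤ (B / c ^ j + ε / 4) + 2 * c * (B / c ^ (j + 1) + ε / (4 * c)) +
        c ^ 2 * (B / c ^ (j + 2) + ε / (4 * c ^ 2)) := by gcongr
    _ = 4 * B / c ^ j + ε := by
        field_simp
        ring


/-- Eq. 21: if the sliding variable
`s = ∑_{i=0}^{n-1} C(n-1,i) λ^{n-1-i} x̃⁽ⁱ⁾` remains inside the boundary layer `|s| ≤ φ`
for all `t ≥ 0` (with `n ≥ 3`), then `limsup_{t→∞} |x̃''(t)| ≤ 6φ/λ^{n-3}` in the sense
that for every `ε > 0` eventually `|x̃''(t)| ≤ 6φ/λ^{n-3} + ε`. -/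
theorem smc_tracking_error_second_deriv_bound (lam φ : ℝ) (hlam : 0 < lam) (hφ : 0 < φ)
    (n : ℕ) (hn : 3 ≤ n) (xt : ℝ → ℝ) (hxt : ContDiff ℝ (n - 1 : ℕ) xt)
    (hs : ∀ t ≥ (0 : ℝ),
      |∑ i ∈ Finset.range n, ((n - 1).choose i : ℝ) * lam ^ (n - 1 - i) * iteratedDeriv i xt t|
        ≤ φ) :
    ∀ ε > (0 : ℝ), ∃ T ≥ (0 : ℝ), ∀ t ≥ T,
      |iteratedDeriv 2 xt t| ≤ 6 * φ / lam ^ (n - 3) + ε := by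
  obtain ⟨j, rfl⟩ : ∃ j, n = 2 + j + 1 := ⟨n - 3, by lia⟩
  simp only [Nat.add_sub_cancel] at hxt hs
  intro ε hε
  have hB : ∀ ε > (0 : ℝ), ∀ᶠ t in Filter.atTop,
      |shiftedIteratedDeriv lam xt (2 + j) t| ≤ φ + ε := fun ε hε ↦ by
    filter_upwards [Filter.eventually_ge_atTop 0] with t ht
    exact (hs t ht).trans (by linarith)
  obtain ⟨T, hT⟩ := Filter.eventually_atTop.1
    (eventually_abs_iteratedDeriv_two_le hlam hxt hB ε hε)
  refine ⟨max T 0, le_max_right _ _, fun t ht ↦ (hT t ((le_max_left _ _).trans ht)).trans ?_⟩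
  rw [show 2 + j + 1 - 3 = j by lia]
  gcongr
  norm_num
end

section
/- Define ζ : ℕ → ℕ by ζ₀ = 1 and ζᵢ = 1 + Σ_{j=0}^{i−1} C(i, j)·ζⱼ for i ≥ 1, where C(i,j) denotes the binomial coefficient. Then ζ₀ = 1, ζ₁ = 2, and ζᵢ > 2ⁱ for every i ≥ 2. -/
/-- Remark: the sequence `ζ` defined by `ζ 0 = 1` and
`ζ i = 1 + ∑_{j<i} C(i,j) ζ j` satisfies `ζ 0 = 1`, `ζ 1 = 2`, and `ζ i > 2^i` for every
`i ≥ 2` (correcting Slotine's claim that the coefficients are `2^i`). -/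
theorem smc_zeta_vs_slotine (ζ : ℕ → ℕ) (hζ0 : ζ 0 = 1)
    (hζ : ∀ i, 1 ≤ i → ζ i = 1 + ∑ j ∈ Finset.range i, i.choose j * ζ j) :
    ζ 0 = 1 ∧ ζ 1 = 2 ∧ ∀ i, 2 ≤ i → 2 ^ i < ζ i := by
  have one_le : ∀ i, 1 ≤ ζ i := by
    intro i
    rcases Nat.eq_zero_or_pos i with rfl | hi
    · exact hζ0.ge
    · rw [hζ i hi]
      exact Nat.le_add_right 1 _
  have ζ_one : ζ 1 = 2 := by
    rw [hζ 1 le_rfl]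
    simp [hζ0]
  refine ⟨hζ0, ζ_one, fun i hi => ?_⟩
  have sum_choose : 1 + ∑ j ∈ Finset.range i, i.choose j = 2 ^ i := by
    rw [← Nat.sum_range_choose, Finset.sum_range_succ, Nat.choose_self, add_comm]
  rw [hζ i (by lia), ← sum_choose]
  refine Nat.add_lt_add_left (Finset.sum_lt_sum
    (fun j _ => Nat.le_mul_of_pos_right _ (one_le j))
    ⟨1, Finset.mem_range.2 hi, ?_⟩) 1
  rw [Nat.choose_one_right, ζ_one]
  lia
end
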